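/- With the setup as in the context, set d̄ := max_{i∈B} d_i/g_i(0), d := min_{i∈A} c_i/g_i(0), and a := d/d̄. Define the base point x₀ := (g_i(0))_{i∈I} ∈ ℝ^I and the reparametrized path γ(u) := (g_i(a·e^{2u}))_{i∈I} for u ≥ 0, and for strictly positive vectors u, v ∈ ℝ^I let D̃(u,v) := (1/2)·max_{i∈I} log(v_i/u_i) + (1/2)·max_{i∈I} log(u_i/v_i). Then for every ε > 0 there exists T > 0 such that |D̃(x₀, γ(s)) + D̃(γ(s), γ(t)) − t| < ε for all t ≥ s ≥ T; i.e. the reparametrized path γ is an almost geodesic for D̃ based at x₀. (This is the analytic content of the Main Theorem: after reparametrization, every earthquake ray is an almost geodesic for the Hilbert metric d_h^Γ on Teichmüller space.) -/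

import Mathlib

open Filter

/-- The abstract Hilbert distance between two strictly positive vectors:
`D(u,v) = (1/2)·max_i log(v i/u i) + (1/2)·max_i log(u i/v i)`. -/
noncomputable def Dtil {I : Type*} [Fintype I] [Nonempty I] (u v : I → ℝ) : ℝ :=
  (1 / 2) * (Finset.univ.sup' Finset.univ_nonempty fun i => Real.log (v i / u i)) +
  (1 / 2) * (Finset.univ.sup' Finset.univ_nonempty fun i => Real.log (u i / v i))

theorem sup_close {I : Type*} [Fintype I] [Nonempty I] (f : I → ℝ) (x e : ℝ)
    (h1 : ∀ i, f i ≤ x + e) (j : I) (h2 : x - e ≤ f j) :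
    |Finset.univ.sup' Finset.univ_nonempty f - x| ≤ e := by
  have h3 : Finset.univ.sup' Finset.univ_nonempty f ≤ x + e :=
    Finset.sup'_le _ _ (fun i _ => h1 i)
  have h4 : f j ≤ Finset.univ.sup' Finset.univ_nonempty f :=
    Finset.le_sup' f (Finset.mem_univ j)
  rw [abs_le]
  constructor <;> linarith

/-- Analytic content of the Main Theorem: after the reparametrization
`γ(u) = (g i (a·e^{2u}))_i` with `a = d/d̄`, the (abstracted) earthquake ray is an
almost geodesic for the Hilbert metric `D̃` based at `x₀ = (g i 0)_i`: for every
`ε > 0` there is `T > 0` with `|D̃(x₀,γ(s)) + D̃(γ(s),γ(t)) − t| < ε` for all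
`t ≥ s ≥ T`. -/
theorem stmt12 {I : Type*} [Fintype I] [Nonempty I]
    (ρ₀ : ℝ) (hρ₀ : 0 < ρ₀)
    (g : I → ℝ → ℝ) (hg : ∀ i, ∀ t : ℝ, 0 ≤ t → 2 * ρ₀ ≤ g i t)
    (A B : Finset I) (hA : A.Nonempty) (hB : B.Nonempty)
    (hcover : ∀ i : I, i ∈ A ∨ i ∈ B) (hdisj : Disjoint A B)
    (c : I → ℝ)
    (hc : ∀ i ∈ A, 0 < c i ∧ Tendsto (fun t : ℝ => g i t) atTop (nhds (c i)))
    (d : I → ℝ)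
    (hd : ∀ i ∈ B, 0 < d i ∧ Tendsto (fun t : ℝ => g i t / t) atTop (nhds (d i)))
    (a : ℝ)
    (ha : a = (A.inf' hA fun i => c i / g i 0) / (B.sup' hB fun i => d i / g i 0)) :
    ∀ ε > 0, ∃ T > 0, ∀ s t : ℝ, T ≤ s → s ≤ t →
      |Dtil (fun i => g i 0) (fun i => g i (a * Real.exp (2 * s))) +
        Dtil (fun i => g i (a * Real.exp (2 * s))) (fun i => g i (a * Real.exp (2 * t))) -
        t| < ε := by
  intro ε hε
  have hpos : ∀ i, ∀ t : ℝ, 0 ≤ t → 0 < g i t := fun i t ht => by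
    have := hg i t ht
    linarith
  obtain ⟨i0, hi0, ei0⟩ := Finset.exists_mem_eq_inf' hA (fun i => c i / g i 0)
  obtain ⟨j0, hj0, ej0⟩ := Finset.exists_mem_eq_sup' hB (fun i => d i / g i 0)
  have hA1 : ∀ i ∈ A, c i0 / g i0 0 ≤ c i / g i 0 := fun i hi => by
    rw [← ei0]
    exact Finset.inf'_le (fun i => c i / g i 0) hi
  have hB1 : ∀ i ∈ B, d i / g i 0 ≤ d j0 / g j0 0 := fun i hi => by
    rw [← ej0]
    exact Finset.le_sup' (fun i => d i / g i 0) hi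
  rw [ei0, ej0] at ha
  have p0 : ∀ i, 0 < g i 0 := fun i => hpos i 0 le_rfl
  have hx : 0 < c i0 / g i0 0 := div_pos (hc i0 hi0).1 (p0 _)
  have hy : 0 < d j0 / g j0 0 := div_pos (hd j0 hj0).1 (p0 _)
  have ha0 : 0 < a := by rw [ha]; exact div_pos hx hy
  have hla : Real.log a = Real.log (c i0 / g i0 0) - Real.log (d j0 / g j0 0) := by
    rw [ha, Real.log_div hx.ne' hy.ne']
  rw [Real.log_div (hc i0 hi0).1.ne' (p0 _).ne',
    Real.log_div (hd j0 hj0).1.ne' (p0 _).ne'] at hla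
  have hA2 : ∀ i ∈ A, Real.log (c i0) - Real.log (g i0 0) ≤ Real.log (c i) - Real.log (g i 0) := by
    intro i hi
    have := Real.log_le_log hx (hA1 i hi)
    rwa [Real.log_div (hc i0 hi0).1.ne' (p0 _).ne',
      Real.log_div (hc i hi).1.ne' (p0 _).ne'] at this
  have hB2 : ∀ i ∈ B, Real.log (d i) - Real.log (g i 0) ≤ Real.log (d j0) - Real.log (g j0 0) := by
    intro i hi
    have := Real.log_le_log (div_pos (hd i hi).1 (p0 i)) (hB1 i hi)
    rwa [Real.log_div (hd j0 hj0).1.ne' (p0 _).ne',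
      Real.log_div (hd i hi).1.ne' (p0 _).ne'] at this
  have t2 : Tendsto (fun s : ℝ => 2 * s) atTop atTop :=
    tendsto_id.const_mul_atTop (by norm_num)
  have tτ : Tendsto (fun s : ℝ => a * Real.exp (2 * s)) atTop atTop :=
    (Real.tendsto_exp_atTop.comp t2).const_mul_atTop ha0
  have τpos : ∀ s : ℝ, 0 < a * Real.exp (2 * s) := fun s => mul_pos ha0 (Real.exp_pos _)
  have lτ : ∀ s : ℝ, Real.log (a * Real.exp (2 * s)) = Real.log a + 2 * s := fun s => by
    rw [Real.log_mul ha0.ne' (Real.exp_pos _).ne', Real.log_exp]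
  have gp : ∀ i s, 0 < g i (a * Real.exp (2 * s)) := fun i s => hpos i _ (τpos s).le
  set δ := ε / 4 with hδ
  have hδ0 : 0 < δ := by positivity
  have EA : ∀ᶠ s : ℝ in atTop, ∀ i, i ∈ A →
      |Real.log (g i (a * Real.exp (2 * s))) - Real.log (c i)| < δ := by
    rw [eventually_all]
    intro i
    by_cases hi : i ∈ A
    · have := (((Real.continuousAt_log (hc i hi).1.ne').tendsto.comp
        ((hc i hi).2.comp tτ))).eventually (Metric.ball_mem_nhds _ hδ0)
      filter_upwards [this] with s hs _
      simpa [Real.dist_eq] using hs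
    · exact Eventually.of_forall fun _ h => absurd h hi
  have EB : ∀ᶠ s : ℝ in atTop, ∀ i, i ∈ B →
      |Real.log (g i (a * Real.exp (2 * s))) - (Real.log a + 2 * s) - Real.log (d i)| < δ := by
    rw [eventually_all]
    intro i
    by_cases hi : i ∈ B
    · have := (((Real.continuousAt_log (hd i hi).1.ne').tendsto.comp
        ((hd i hi).2.comp tτ))).eventually (Metric.ball_mem_nhds _ hδ0)
      filter_upwards [this] with s hs _
      rw [Real.dist_eq] at hs
      simp only [Function.comp] at hs
      rwa [Real.log_div (gp i s).ne' (τpos s).ne', lτ] at hs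
    · exact Eventually.of_forall fun _ h => absurd h hi
  have E1 : ∀ᶠ s : ℝ in atTop, ∀ i,
      Real.log (c i) - Real.log (g i 0) - (Real.log (c i0) - Real.log (g i0 0)) ≤ 2 * s := by
    rw [eventually_all]
    exact fun i => t2.eventually_ge_atTop _
  have E2 : ∀ᶠ s : ℝ in atTop, ∀ i,
      Real.log (d j0) - Real.log (g j0 0) - (Real.log (d i) - Real.log (g i 0)) ≤ 2 * s := by
    rw [eventually_all]
    exact fun i => t2.eventually_ge_atTop _
  obtain ⟨T, hT⟩ := eventually_atTop.1 (EA.and (EB.and (E1.and E2)))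
  refine ⟨max T 1, by positivity, fun s t hs hst => ?_⟩
  obtain ⟨a1, b1, u1, v1⟩ := hT s ((le_max_left _ _).trans hs)
  obtain ⟨a2, b2, -, -⟩ := hT t (((le_max_left _ _).trans hs).trans hst)
  simp only [abs_lt] at a1 b1 a2 b2
  unfold Dtil
  simp only [Real.log_div (gp _ _).ne' (gp _ _).ne', Real.log_div (gp _ _).ne' (p0 _).ne',
    Real.log_div (p0 _).ne' (gp _ _).ne']
  have S1 := sup_close (fun i => Real.log (g i (a * Real.exp (2 * s))) - Real.log (g i 0))
    (Real.log (c i0) - Real.log (g i0 0) + 2 * s) δ (fun i => by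
      rcases hcover i with hi | hi
      · have := a1 i hi
        have := u1 i
        linarith
      · have := b1 i hi
        have := hB2 i hi
        linarith) j0 (by
      have := b1 j0 hj0
      linarith)
  have S2 := sup_close (fun i => Real.log (g i 0) - Real.log (g i (a * Real.exp (2 * s))))
    (-(Real.log (c i0) - Real.log (g i0 0))) δ (fun i => by
      rcases hcover i with hi | hi
      · have := a1 i hi
        have := hA2 i hi
        linarith
      · have := b1 i hi
        have := v1 i
        linarith) i0 (by
      have := a1 i0 hi0
      linarith)
  have S3 := sup_close (fun i => Real.log (g i (a * Real.exp (2 * t))) -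
      Real.log (g i (a * Real.exp (2 * s))))
    (2 * (t - s)) (2 * δ) (fun i => by
      rcases hcover i with hi | hi
      · have := a1 i hi
        have := a2 i hi
        linarith
      · have := b1 i hi
        have := b2 i hi
        linarith) j0 (by
      have := b1 j0 hj0
      have := b2 j0 hj0
      linarith)
  have S4 := sup_close (fun i => Real.log (g i (a * Real.exp (2 * s))) -
      Real.log (g i (a * Real.exp (2 * t))))
    0 (2 * δ) (fun i => by
      rcases hcover i with hi | hi
      · have := a1 i hi
        have := a2 i hi
        linarith
      · have := b1 i hi
        have := b2 i hi
        linarith) i0 (by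
      have := a1 i0 hi0
      have := a2 i0 hi0
      linarith)
  rw [abs_le] at S1 S2 S3 S4
  rw [abs_lt]
  constructor <;> linarith
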